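/- Let (Ω,≤) be a totally ordered set such that Aut(Ω,≤) acts transitively on the set of pairs (α,β) ∈ Ω × Ω with α < β. If Aut(Ω,≤) and Aut(ℝ,≤) are elementarily equivalent in the first-order language of lattice-ordered groups, then Ω is isomorphic to ℝ as an ordered set. -/

import Mathlib

/-!  Common framework for ℓ-permutation groups on a totally ordered set. -/

namespace LPerm

variable {Ω : Type*} [LinearOrder Ω]

/-- Pointwise join of two order automorphisms of a totally ordered set. -/
def autSup (f g : Ω ≃o Ω) : Ω ≃o Ω :=
  Equiv.toOrderIso
    { toFun := fun α => max (f α) (g α)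
      invFun := fun α => min (f.symm α) (g.symm α)
      left_inv := by
        intro α
        dsimp only
        rcases le_total (f α) (g α) with h | h
        · rw [max_eq_right h]
          have h1 : α ≤ f.symm (g α) := by
            have := f.symm.monotone h
            simpa using this
          rw [g.symm_apply_apply, min_eq_right h1]
        · rw [max_eq_left h]
          have h1 : α ≤ g.symm (f α) := by
            have := g.symm.monotone h
            simpa using this
          rw [f.symm_apply_apply, min_eq_left h1]
      right_inv := by
        intro α
        dsimp only
        rcases le_total (f.symm α) (g.symm α) with h | h
        · rw [min_eq_left h]
          have h1 : g (f.symm α) ≤ α := by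
            have := g.monotone h
            simpa using this
          rw [f.apply_symm_apply, max_eq_left h1]
        · rw [min_eq_right h]
          have h1 : f (g.symm α) ≤ α := by
            have := f.monotone h
            simpa using this
          rw [g.apply_symm_apply, max_eq_right h1] }
    (f.monotone.max g.monotone)
    (f.symm.monotone.min g.symm.monotone)

/-- Pointwise meet of two order automorphisms of a totally ordered set. -/
def autInf (f g : Ω ≃o Ω) : Ω ≃o Ω :=
  Equiv.toOrderIso
    { toFun := fun α => min (f α) (g α)
      invFun := fun α => max (f.symm α) (g.symm α)
      left_inv := by
        intro α
        dsimp only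
        rcases le_total (f α) (g α) with h | h
        · rw [min_eq_left h]
          have h1 : g.symm (f α) ≤ α := by
            have := g.symm.monotone h
            simpa using this
          rw [f.symm_apply_apply, max_eq_left h1]
        · rw [min_eq_right h]
          have h1 : f.symm (g α) ≤ α := by
            have := f.symm.monotone h
            simpa using this
          rw [g.symm_apply_apply, max_eq_right h1]
      right_inv := by
        intro α
        dsimp only
        rcases le_total (f.symm α) (g.symm α) with h | h
        · rw [max_eq_right h]
          have h1 : α ≤ f (g.symm α) := by
            have := f.monotone h
            simpa using this
          rw [g.apply_symm_apply, min_eq_right h1]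
        · rw [max_eq_left h]
          have h1 : α ≤ g (f.symm α) := by
            have := g.monotone h
            simpa using this
          rw [f.apply_symm_apply, min_eq_left h1] }
    (f.monotone.min g.monotone)
    (f.symm.monotone.max g.symm.monotone)


/-- The pointwise order on order automorphisms: `f ≤ g` iff `f α ≤ g α` for all `α`. -/
def autLe (f g : Ω ≃o Ω) : Prop := ∀ α : Ω, f α ≤ g α

/-- `|g| = g ∨ g⁻¹`. -/
def autAbs (g : Ω ≃o Ω) : Ω ≃o Ω := autSup g g⁻¹

/-- The support of an automorphism. -/
def supp (g : Ω ≃o Ω) : Set Ω := {α | g α ≠ α}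

/-- Conjugation, written `h^g = g⁻¹ h g` in the paper. -/
def aconj (h g : Ω ≃o Ω) : Ω ≃o Ω := g⁻¹ * h * g

/-- The commutator `[a,b] = a⁻¹ b⁻¹ a b`. -/
def pcomm (a b : Ω ≃o Ω) : Ω ≃o Ω := a⁻¹ * b⁻¹ * a * b

/-- `G` is closed under the pointwise lattice operations, i.e. `(G,Ω)` is an
ℓ-permutation group. -/
def SublatticeClosed (G : Subgroup (Ω ≃o Ω)) : Prop :=
  ∀ f g : Ω ≃o Ω, f ∈ G → g ∈ G → autSup f g ∈ G ∧ autInf f g ∈ G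

/-- `(G,Ω)` is transitive. -/
def IsTransitive (G : Subgroup (Ω ≃o Ω)) : Prop :=
  ∀ α β : Ω, ∃ g ∈ G, g α = β

/-- `(G,Ω)` is o-2 transitive. -/
def IsO2Transitive (G : Subgroup (Ω ≃o Ω)) : Prop :=
  ∀ α₁ α₂ β₁ β₂ : Ω, α₁ < α₂ → β₁ < β₂ → ∃ g ∈ G, g α₁ = β₁ ∧ g α₂ = β₂

/-- A convex `G`-congruence: an equivalence relation with convex classes which is
preserved by the action of `G`. -/
def IsConvexCongruence (G : Subgroup (Ω ≃o Ω)) (r : Ω → Ω → Prop) : Prop :=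
  Equivalence r ∧ (∀ α β γ : Ω, r α γ → α ≤ β → β ≤ γ → r α β) ∧
    ∀ g ∈ G, ∀ α β : Ω, r α β → r (g α) (g β)

/-- `V(α,β)`: the intersection of all convex `G`-congruences under which `α` and `β`
are equivalent. -/
def Vcong (G : Subgroup (Ω ≃o Ω)) (α β : Ω) : Ω → Ω → Prop :=
  fun γ δ => ∀ r : Ω → Ω → Prop, IsConvexCongruence G r → r α β → r γ δ

/-- Membership in the spine `𝔎` of `(G,Ω)`. -/
def SpineMem (G : Subgroup (Ω ≃o Ω)) (r : Ω → Ω → Prop) : Prop :=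
  ∃ α β : Ω, α ≠ β ∧ r = Vcong G α β

/-- Inclusion of relations. -/
def relLe (r s : Ω → Ω → Prop) : Prop := ∀ x y : Ω, r x y → s x y

/-- `Δ ∈ T`: `Δ` is an o-block (class) of a member of the spine `𝔎`. -/
def InT (G : Subgroup (Ω ≃o Ω)) (Δ : Set Ω) : Prop :=
  ∃ r : Ω → Ω → Prop, SpineMem G r ∧ ∃ δ : Ω, Δ = {γ | r δ γ}

/-- `Δ` is a class (o-block) of the relation `r`. -/
def IsBlockOf (r : Ω → Ω → Prop) (Δ : Set Ω) : Prop :=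
  ∃ δ : Ω, Δ = {γ | r δ γ}

/-- The restricted stabiliser `rst(S) = {g ∈ G ∣ supp g ⊆ S}`. -/
def rst (G : Subgroup (Ω ≃o Ω)) (S : Set Ω) : Set (Ω ≃o Ω) :=
  {g | g ∈ G ∧ supp g ⊆ S}

/-- The (setwise) stabiliser `st(Δ) = {g ∈ G ∣ Δg = Δ}`. -/
def stab (G : Subgroup (Ω ≃o Ω)) (Δ : Set Ω) : Set (Ω ≃o Ω) :=
  {g | g ∈ G ∧ g '' Δ = Δ}

/-- `Q_Δ = {h ∈ rst(Δ) ∣ ∃ α ∈ Δ, V(α, αh) = κ(Δ)}`; since `κ(Δ)` is the unique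
convex congruence having `Δ` as a class, the condition `V(α,αh) = κ(Δ)` says exactly
that `Δ` is the class of `V(α, αh)` containing `α`. -/
def Qset (G : Subgroup (Ω ≃o Ω)) (Δ : Set Ω) : Set (Ω ≃o Ω) :=
  {h | h ∈ rst G Δ ∧ ∃ α ∈ Δ, Δ = {γ | Vcong G α (h α) α γ}}

/-- `(G,Ω)` is ample: `Q_Δ ≠ ∅` for every `Δ ∈ T`. -/
def Ample (G : Subgroup (Ω ≃o Ω)) : Prop :=
  ∀ Δ : Set Ω, InT G Δ → (Qset G Δ).Nonempty

/-- `(G,Ω)` is abundant: for every `Δ ∈ T` and `g ∈ st(Δ)`, the automorphism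
`dep(g,Δ)` agreeing with `g` on `Δ` and with the identity elsewhere lies in `G`. -/
def Abundant (G : Subgroup (Ω ≃o Ω)) : Prop :=
  ∀ Δ : Set Ω, InT G Δ → ∀ g ∈ stab G Δ,
    ∃ g₀ ∈ G, (∀ α ∈ Δ, g₀ α = g α) ∧ ∀ α ∉ Δ, g₀ α = α

/-- The spine `𝔎` has no minimal element. -/
def SpineNoMin (G : Subgroup (Ω ≃o Ω)) : Prop :=
  ∀ r : Ω → Ω → Prop, SpineMem G r →
    ∃ r' : Ω → Ω → Prop, SpineMem G r' ∧ relLe r' r ∧ r' ≠ r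

/-- `Δ` is a minimal element of `T`. -/
def MinimalInT (G : Subgroup (Ω ≃o Ω)) (Δ : Set Ω) : Prop :=
  InT G Δ ∧ ∀ Δ' : Set Ω, InT G Δ' → Δ' ⊆ Δ → Δ' = Δ

/-- Hypothesis (†): if `T` has a minimal element `Δ₀`, then every (nondegenerate
bounded) interval of `Δ₀` supports a non-trivial element of `G`. -/
def Dagger (G : Subgroup (Ω ≃o Ω)) : Prop :=
  ∀ Δ₀ : Set Ω, MinimalInT G Δ₀ → ∀ α β : Ω, α ∈ Δ₀ → β ∈ Δ₀ → α < β →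
    ∃ g : Ω ≃o Ω, g ∈ G ∧ g ≠ 1 ∧ supp g ⊆ Set.Ioo α β

/-- `X_h = {[h⁻¹, h^g] ∣ g ∈ G}`. -/
def Xset (G : Subgroup (Ω ≃o Ω)) (h : Ω ≃o Ω) : Set (Ω ≃o Ω) :=
  {x | ∃ g ∈ G, x = pcomm h⁻¹ (aconj h g)}

/-- `W_h = ⋃ {X_{h^g} ∣ g ∈ G, [X_h, X_{h^g}] ≠ 1}`. -/
def Wset (G : Subgroup (Ω ≃o Ω)) (h : Ω ≃o Ω) : Set (Ω ≃o Ω) :=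
  {x | ∃ g ∈ G, (∃ a ∈ Xset G h, ∃ b ∈ Xset G (aconj h g), pcomm a b ≠ 1) ∧
    x ∈ Xset G (aconj h g)}

/-- The centraliser of a subset `S` in `G`. -/
def cent (G : Subgroup (Ω ≃o Ω)) (S : Set (Ω ≃o Ω)) : Set (Ω ≃o Ω) :=
  {f | f ∈ G ∧ ∀ s ∈ S, s * f = f * s}

/-- The double centraliser of a subset `S` in `G`. -/
def cent2 (G : Subgroup (Ω ≃o Ω)) (S : Set (Ω ≃o Ω)) : Set (Ω ≃o Ω) :=
  cent G (cent G S)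

/-- The pointwise stabiliser in `G` of a subset `S ⊆ Ω`. -/
def ptStab (G : Subgroup (Ω ≃o Ω)) (S : Set Ω) : Set (Ω ≃o Ω) :=
  {f | f ∈ G ∧ ∀ α ∈ S, f α = α}

/-- The congruence covered by `K`: the union of all convex `G`-congruences properly
contained in `K`. -/
def coveredRel (G : Subgroup (Ω ≃o Ω)) (K : Ω → Ω → Prop) : Ω → Ω → Prop :=
  fun γ δ => ∃ r : Ω → Ω → Prop, IsConvexCongruence G r ∧ relLe r K ∧ r ≠ K ∧ r γ δ

/-- `Γ ∈ π(Δ)`, where `K = κ(Δ)`: `Γ` is a class of the congruence covered by `K`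
contained in `Δ`. -/
def InPi (G : Subgroup (Ω ≃o Ω)) (K : Ω → Ω → Prop) (Δ Γ : Set Ω) : Prop :=
  ∃ δ ∈ Δ, Γ = {γ | coveredRel G K δ γ}

/-- An irreducible element of `G`. -/
def IsIrreducibleElt (G : Subgroup (Ω ≃o Ω)) (g : Ω ≃o Ω) : Prop :=
  autLe 1 g ∧ g ≠ 1 ∧
    ∀ g₁ g₂ : Ω ≃o Ω, g₁ ∈ G → g₂ ∈ G → autSup g₁ g₂ = g → autInf g₁ g₂ = 1 →
      g₁ = 1 ∨ g₂ = 1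

/-- `(G,Ω)` is controlled. -/
def Controlled (G : Subgroup (Ω ≃o Ω)) : Prop :=
  ∀ Δ : Set Ω, InT G Δ → ¬ MinimalInT G Δ → ∀ g ∈ rst G Δ,
    (∃ δ ∈ Δ ∩ supp g, Δ = {γ | Vcong G δ (g δ) δ γ}) ∨
      ∃ Δ' : Set Ω, InT G Δ' ∧ supp g ⊆ Δ' ∧ Δ' ⊂ Δ


/-- Function symbols of the first-order language of lattice-ordered groups:
multiplication, inversion, identity, join and meet. -/
inductive LGFunc : ℕ → Type
  | mul : LGFunc 2
  | inv : LGFunc 1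
  | one : LGFunc 0
  | join : LGFunc 2
  | meet : LGFunc 2

/-- The first-order language of lattice-ordered groups. -/
def LGLang : FirstOrder.Language where
  Functions := LGFunc
  Relations := fun _ => Empty

/-- The automorphism group of a totally ordered set as a structure for the
first-order language of lattice-ordered groups, with the pointwise lattice
operations. -/
noncomputable instance autLGStructure (Ω : Type*) [LinearOrder Ω] :
    LGLang.Structure (Ω ≃o Ω) where
  funMap {_} f x :=
    match f with
    | .mul => x 0 * x 1
    | .inv => (x 0)⁻¹
    | .one => 1
    | .join => autSup (x 0) (x 1)
    | .meet => autInf (x 0) (x 1)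
  RelMap {_} r _ := r.elim

section Properties

/-- `h` is a nontrivial positive element of the centralizer of `{f, g}`. -/
def PosCent (f g h : Ω ≃o Ω) : Prop :=
  h * f = f * h ∧ h * g = g * h ∧ autSup 1 h = h ∧ h ≠ 1

/-- `u` is not the join of two nontrivial disjoint elements. -/
def Unsplit (u : Ω ≃o Ω) : Prop :=
  ∀ a b : Ω ≃o Ω, autSup a b = u → autInf a b = 1 → a = 1 ∨ b = 1

/-- Some centralizer of a pair has a totally ordered positive cone consisting of unsplit
elements of full support, closed under halving, and not bounded below by any `u > 1`. -/
def HasSmallCentralizer (Ω : Type*) [LinearOrder Ω] : Prop :=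
  ∃ f g : Ω ≃o Ω, PosCent f g f ∧
    (∀ h : Ω ≃o Ω, PosCent f g h →
      Unsplit h ∧ (∀ k : Ω ≃o Ω, autInf k h = 1 → k = 1) ∧
      (∃ k : Ω ≃o Ω, PosCent f g k ∧ autSup (k * k) h = h) ∧
      ∀ k : Ω ≃o Ω, PosCent f g k → autSup h k = k ∨ autSup k h = h) ∧
    ∀ u : Ω ≃o Ω, autSup 1 u = u → u ≠ 1 → ∃ h : Ω ≃o Ω, PosCent f g h ∧ autSup u h ≠ h

/-- `u` is a positive element with a single, bounded supporting interval. -/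
def IsBump (u : Ω ≃o Ω) : Prop :=
  autSup 1 u = u ∧ u ≠ 1 ∧ Unsplit u ∧ ∃ h : Ω ≃o Ω, autInf u (h * u * h⁻¹) = 1

/-- Any two bumps have, up to conjugation, the same disjoint elements. -/
def BumpsPolarConj (Ω : Type*) [LinearOrder Ω] : Prop :=
  ∀ u v : Ω ≃o Ω, IsBump u → IsBump v →
    ∃ h : Ω ≃o Ω, ∀ k : Ω ≃o Ω, autInf k (h * u * h⁻¹) = 1 ↔ autInf k v = 1

end Properties

section Formulas

open FirstOrder Language

variable {α : Type}

/-- Product of terms. -/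
def tmul (s t : LGLang.Term α) : LGLang.Term α :=
  Functions.apply₂ (L := LGLang) LGFunc.mul s t

/-- Join of terms. -/
def tjoin (s t : LGLang.Term α) : LGLang.Term α :=
  Functions.apply₂ (L := LGLang) LGFunc.join s t

/-- Meet of terms. -/
def tmeet (s t : LGLang.Term α) : LGLang.Term α :=
  Functions.apply₂ (L := LGLang) LGFunc.meet s t

/-- Inverse of a term. -/
def tinv (s : LGLang.Term α) : LGLang.Term α :=
  Functions.apply₁ (L := LGLang) LGFunc.inv s

/-- The identity as a term. -/
def tone : LGLang.Term α :=
  Constants.term (L := LGLang) LGFunc.one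

variable (v : α → (Ω ≃o Ω))

lemma realize_tmul (s t : LGLang.Term α) :
    (tmul s t).realize v = s.realize v * t.realize v := rfl

lemma realize_tjoin (s t : LGLang.Term α) :
    (tjoin s t).realize v = autSup (s.realize v) (t.realize v) := rfl

lemma realize_tmeet (s t : LGLang.Term α) :
    (tmeet s t).realize v = autInf (s.realize v) (t.realize v) := rfl

lemma realize_tinv (s : LGLang.Term α) : (tinv s).realize v = (s.realize v)⁻¹ := rfl

lemma realize_tone : (tone : LGLang.Term α).realize v = 1 := rfl

variable {n : ℕ}

/-- The formula expressing `PosCent`. -/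
def posCentFormula (f g h : LGLang.Term (Empty ⊕ Fin n)) : LGLang.BoundedFormula Empty n :=
  (tmul h f =' tmul f h) ⊓ ((tmul h g =' tmul g h) ⊓ ((tjoin tone h =' h) ⊓ ∼(h =' tone)))

/-- The matrix of the formula expressing `Unsplit`. -/
def unsplitMatrix (u a b : LGLang.Term (Empty ⊕ Fin n)) : LGLang.BoundedFormula Empty n :=
  (tjoin a b =' u) ⟹ ((tmeet a b =' tone) ⟹ ((a =' tone) ⊔ (b =' tone)))

lemma realize_posCentFormula (f g h : LGLang.Term (Empty ⊕ Fin n))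
    (v : Empty → (Ω ≃o Ω)) (xs : Fin n → (Ω ≃o Ω)) :
    (posCentFormula f g h).Realize v xs ↔ PosCent (f.realize (Sum.elim v xs))
      (g.realize (Sum.elim v xs)) (h.realize (Sum.elim v xs)) := by
  simp only [posCentFormula, PosCent, BoundedFormula.realize_inf, BoundedFormula.realize_not,
    BoundedFormula.realize_bdEqual, realize_tmul, realize_tjoin, realize_tone]

lemma realize_unsplitMatrix (u a b : LGLang.Term (Empty ⊕ Fin n))
    (v : Empty → (Ω ≃o Ω)) (xs : Fin n → (Ω ≃o Ω)) :
    (unsplitMatrix u a b).Realize v xs ↔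
      (autSup (a.realize (Sum.elim v xs)) (b.realize (Sum.elim v xs)) =
        u.realize (Sum.elim v xs) →
      autInf (a.realize (Sum.elim v xs)) (b.realize (Sum.elim v xs)) = 1 →
      a.realize (Sum.elim v xs) = 1 ∨ b.realize (Sum.elim v xs) = 1) := by
  simp only [unsplitMatrix, BoundedFormula.realize_imp, BoundedFormula.realize_sup,
    BoundedFormula.realize_bdEqual, realize_tmeet, realize_tjoin, realize_tone]

/-- The sentence expressing `HasSmallCentralizer`. -/
def smallCentralizerSentence : LGLang.Sentence :=
  ∃' ∃' (posCentFormula (&0) (&1) (&0) ⊓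
    ((∀' (posCentFormula (&0) (&1) (&2) ⟹
      ((∀' ∀' unsplitMatrix (&2) (&3) (&4)) ⊓
      ((∀' ((tmeet (&3) (&2) =' tone) ⟹ (&3 =' tone))) ⊓
      ((∃' (posCentFormula (&0) (&1) (&3) ⊓ (tjoin (tmul (&3) (&3)) (&2) =' &2))) ⊓
       (∀' (posCentFormula (&0) (&1) (&3) ⟹
        ((tjoin (&2) (&3) =' &3) ⊔ (tjoin (&3) (&2) =' &2))))))))) ⊓
    (∀' ((tjoin tone (&2) =' &2) ⟹ (∼(&2 =' tone) ⟹
      (∃' (posCentFormula (&0) (&1) (&3) ⊓ ∼(tjoin (&2) (&3) =' &3))))))))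

lemma realize_smallCentralizerSentence (Ω : Type*) [LinearOrder Ω] :
    (Ω ≃o Ω) ⊨ smallCentralizerSentence ↔ HasSmallCentralizer Ω := by
  simp only [Sentence.Realize, Formula.Realize, smallCentralizerSentence,
    realize_posCentFormula, realize_unsplitMatrix, BoundedFormula.realize_ex,
    BoundedFormula.realize_all, BoundedFormula.realize_inf, BoundedFormula.realize_imp,
    BoundedFormula.realize_sup, BoundedFormula.realize_not, BoundedFormula.realize_bdEqual,
    realize_tmul, realize_tjoin, realize_tmeet, realize_tone]
  rfl

/-- The sentence expressing `BumpsPolarConj`. -/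
def bumpsPolarConjSentence : LGLang.Sentence :=
  ∀' ∀'
    (((tjoin tone (&0) =' &0) ⊓ (∼(&0 =' tone) ⊓ ((∀' ∀' unsplitMatrix (&0) (&2) (&3)) ⊓
      ∃' (tmeet (&0) (tmul (tmul (&2) (&0)) (tinv (&2))) =' tone)))) ⟹
    (((tjoin tone (&1) =' &1) ⊓ (∼(&1 =' tone) ⊓ ((∀' ∀' unsplitMatrix (&1) (&2) (&3)) ⊓
      ∃' (tmeet (&1) (tmul (tmul (&2) (&1)) (tinv (&2))) =' tone)))) ⟹
    ∃' ∀' ((tmeet (&3) (tmul (tmul (&2) (&0)) (tinv (&2))) =' tone).iff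
        (tmeet (&3) (&1) =' tone))))

lemma realize_bumpsPolarConjSentence (Ω : Type*) [LinearOrder Ω] :
    (Ω ≃o Ω) ⊨ bumpsPolarConjSentence ↔ BumpsPolarConj Ω := by
  simp only [Sentence.Realize, Formula.Realize, bumpsPolarConjSentence, realize_unsplitMatrix,
    BoundedFormula.realize_ex, BoundedFormula.realize_all, BoundedFormula.realize_inf,
    BoundedFormula.realize_imp, BoundedFormula.realize_not, BoundedFormula.realize_bdEqual,
    BoundedFormula.realize_iff, realize_tmul, realize_tjoin, realize_tmeet, realize_tone,
    realize_tinv]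
  rfl

end Formulas

section Pointwise

lemma autSup_apply (f g : Ω ≃o Ω) (x : Ω) : autSup f g x = max (f x) (g x) := rfl

lemma autInf_apply (f g : Ω ≃o Ω) (x : Ω) : autInf f g x = min (f x) (g x) := rfl

lemma autSup_eq_right_iff (f g : Ω ≃o Ω) : autSup f g = g ↔ ∀ x, f x ≤ g x := by
  simp [DFunLike.ext_iff, autSup_apply]

lemma autSup_one_eq_iff (g : Ω ≃o Ω) : autSup 1 g = g ↔ ∀ x, x ≤ g x :=
  autSup_eq_right_iff 1 g

lemma autInf_eq_one_iff (f g : Ω ≃o Ω) : autInf f g = 1 ↔ ∀ x, min (f x) (g x) = x := by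
  simp [DFunLike.ext_iff, autInf_apply]

lemma autInf_eq_one_iff_of_one_le {v : Ω ≃o Ω} (hv : ∀ x, x ≤ v x) (k : Ω ≃o Ω) :
    autInf k v = 1 ↔ ∀ x, x ≤ k x ∧ (v x ≠ x → k x = x) := by
  rw [autInf_eq_one_iff]
  refine forall_congr' fun x => ⟨fun h => ⟨?_, fun hx => ?_⟩, fun h => ?_⟩
  · exact h.symm.le.trans (min_le_left _ _)
  · rcases min_choice (k x) (v x) with h' | h'
    · exact h'.symm.trans h
    · exact absurd (h'.symm.trans h) hx
  · by_cases hx : v x = x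
    · rw [hx, min_eq_right h.1]
    · rw [h.2 hx, min_eq_left (hv x)]

lemma ne_one_iff_exists (u : Ω ≃o Ω) : u ≠ 1 ↔ ∃ x, u x ≠ x := by
  simp [DFunLike.ext_iff]

lemma inv_apply_eq_symm (u : Ω ≃o Ω) (x : Ω) : u⁻¹ x = u.symm x := rfl

lemma conj_one_le {u : Ω ≃o Ω} (hu : ∀ x, x ≤ u x) (h : Ω ≃o Ω) (x : Ω) :
    x ≤ (h * u * h⁻¹) x := by
  have := h.monotone (hu (h⁻¹ x))
  simpa [inv_apply_eq_symm] using this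

lemma conj_apply_ne_iff (u h : Ω ≃o Ω) (x : Ω) :
    (h * u * h⁻¹) x ≠ x ↔ u (h.symm x) ≠ h.symm x := by
  rw [not_iff_not, RelIso.mul_apply, RelIso.mul_apply, inv_apply_eq_symm,
    ← OrderIso.eq_symm_apply]

lemma zpow_succ_apply (u : Ω ≃o Ω) (n : ℤ) (x : Ω) : (u ^ (n + 1)) x = u ((u ^ n) x) := by
  rw [add_comm, zpow_one_add, RelIso.mul_apply]

lemma zpow_apply_mono {u : Ω ≃o Ω} (hu : ∀ x, x ≤ u x) (x : Ω) :
    Monotone fun n : ℤ => (u ^ n) x :=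
  monotone_int_of_le_succ fun n => by
    rw [zpow_succ_apply]
    exact hu _

lemma zpow_apply_eq_self {u : Ω ≃o Ω} {x : Ω} (hx : u x = x) (n : ℤ) : (u ^ n) x = x := by
  induction n using Int.induction_on with
  | zero => simp
  | succ n ih => rw [zpow_succ_apply, ih, hx]
  | pred n ih =>
    apply u.injective
    rw [← zpow_succ_apply, sub_add_cancel, ih, hx]

end Pointwise

section Gluing

/-- An order automorphism of a convex subset extends by the identity. -/
lemma exists_extend_by_id {D : Set Ω} (hD : D.OrdConnected) {F : Ω → Ω}
    (hmaps : Set.MapsTo F D D) (hmono : StrictMonoOn F D) (hsurj : Set.SurjOn F D D) :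
    ∃ e : Ω ≃o Ω, (∀ x ∈ D, e x = F x) ∧ ∀ x ∉ D, e x = x := by
  classical
  have h1 : StrictMono fun x => if x ∈ D then F x else x := by
    intro x y hxy
    by_cases hx : x ∈ D <;> by_cases hy : y ∈ D <;> simp only [hx, hy, if_true, if_false]
    · exact hmono hx hy hxy
    · by_contra! h
      exact hy (hD.out hx (hmaps hx) ⟨hxy.le, h⟩)
    · by_contra! h
      exact hx (hD.out (hmaps hy) hy ⟨h, hxy.le⟩)
    · exact hxy
  have h2 : Function.Surjective fun x => if x ∈ D then F x else x := by
    intro y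
    by_cases hy : y ∈ D
    · obtain ⟨x, hx, rfl⟩ := hsurj hy
      exact ⟨x, if_pos hx⟩
    · exact ⟨y, if_neg hy⟩
  refine ⟨StrictMono.orderIsoOfSurjective _ h1 h2, fun x hx => ?_, fun x hx => ?_⟩
  · exact if_pos hx
  · exact if_neg hx

end Gluing

section Unsplit

/-- The support of an unsplit positive element is the convex hull of any orbit in it. -/
lemma Unsplit.exists_zpow_le_le {u : Ω ≃o Ω} (hu : ∀ x, x ≤ u x) (hs : Unsplit u) {x y : Ω}
    (hx : u x ≠ x) (hy : u y ≠ y) : ∃ n m : ℤ, (u ^ n) x ≤ y ∧ y ≤ (u ^ m) x := by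
  set D : Set Ω := {z | ∃ n m : ℤ, (u ^ n) x ≤ z ∧ z ≤ (u ^ m) x} with hDdef
  have hDu : ∀ z, u z ∈ D ↔ z ∈ D := by
    intro z
    constructor
    · rintro ⟨n, m, h1, h2⟩
      refine ⟨n - 1, m - 1, ?_, ?_⟩
      · rw [← u.le_iff_le, ← zpow_succ_apply, sub_add_cancel]
        exact h1
      · rw [← u.le_iff_le, ← zpow_succ_apply, sub_add_cancel]
        exact h2
    · rintro ⟨n, m, h1, h2⟩
      refine ⟨n + 1, m + 1, ?_, ?_⟩
      · rw [zpow_succ_apply]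
        exact u.monotone h1
      · rw [zpow_succ_apply]
        exact u.monotone h2
  have hxD : x ∈ D := ⟨0, 0, by simp, by simp⟩
  have hconv : D.OrdConnected := by
    refine ⟨?_⟩
    rintro a ⟨n, m, h1, h2⟩ b ⟨n', m', h1', h2'⟩ c hc
    exact ⟨n, m', h1.trans hc.1, hc.2.trans h2'⟩
  obtain ⟨e, he, he'⟩ := exists_extend_by_id hconv (F := u) (fun z hz => (hDu z).2 hz)
    (u.strictMono.strictMonoOn D) (fun z hz => ⟨u.symm z, (hDu _).1 (by simpa using hz), by simp⟩)
  have hsplit : ∀ z, (z ∈ D ∧ e z = u z ∧ (e⁻¹ * u) z = z) ∨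
      (z ∉ D ∧ e z = z ∧ (e⁻¹ * u) z = u z) := by
    intro z
    rw [RelIso.mul_apply, inv_apply_eq_symm]
    by_cases hz : z ∈ D
    · exact Or.inl ⟨hz, he z hz, by rw [← he z hz, e.symm_apply_apply]⟩
    · refine Or.inr ⟨hz, he' z hz, ?_⟩
      rw [OrderIso.symm_apply_eq, he' _ (fun h => hz ((hDu z).1 h))]
  have h1 : autSup e (e⁻¹ * u) = u := by
    ext z
    rw [autSup_apply]
    rcases hsplit z with ⟨-, h, h'⟩ | ⟨-, h, h'⟩ <;> rw [h, h'] <;> simp [hu z]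
  have h2 : autInf e (e⁻¹ * u) = 1 := by
    rw [autInf_eq_one_iff]
    intro z
    rcases hsplit z with ⟨-, h, h'⟩ | ⟨-, h, h'⟩ <;> rw [h, h'] <;> simp [hu z]
  rcases hs _ _ h1 h2 with h | h
  · refine absurd ?_ hx
    rw [← he x hxD, h, RelIso.one_apply]
  · by_contra hyD
    rcases hsplit y with ⟨h', -⟩ | ⟨-, -, h'⟩
    · exact hyD h'
    · rw [h, RelIso.one_apply] at h'
      exact hy h'.symm

lemma eq_one_of_fixes_base {u a b : Ω ≃o Ω} {x₀ : Ω} (hx₀ : x₀ < u x₀)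
    (horb : ∀ z, u z ≠ z → ∃ n : ℤ, (u ^ n) x₀ ≤ z ∧ z < (u ^ (n + 1)) x₀)
    (hab : ∀ z, a z = z ∧ b z = u z ∨ b z = z ∧ a z = u z) (ha : a x₀ = x₀) : a = 1 := by
  have hlt : ∀ n : ℤ, (u ^ n) x₀ < u ((u ^ n) x₀) := by
    intro n
    rw [← zpow_succ_apply, zpow_add_one, RelIso.mul_apply]
    exact (u ^ n).strictMono hx₀
  have hfix : ∀ n : ℤ, a ((u ^ n) x₀) = (u ^ n) x₀ := by
    intro n
    induction n using Int.induction_on with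
    | zero => simpa using ha
    | succ n ih =>
      have h := hlt n
      rw [zpow_succ_apply]
      set z := (u ^ (n : ℤ)) x₀
      rcases hab (u z) with ⟨h1, -⟩ | ⟨h1, -⟩
      · exact h1
      · rcases hab z with ⟨-, h2⟩ | ⟨-, h2⟩
        · exact absurd (b.injective (h2.trans h1.symm)) h.ne
        · exact absurd (ih.symm.trans h2) h.ne
    | pred n ih =>
      have h := hlt (-n - 1)
      have h3 : u ((u ^ (-(n : ℤ) - 1)) x₀) = (u ^ (-(n : ℤ))) x₀ := by
        rw [← zpow_succ_apply, sub_add_cancel]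
      rw [← h3] at ih
      set z := (u ^ (-(n : ℤ) - 1)) x₀
      rcases hab z with ⟨h1, -⟩ | ⟨-, h1⟩
      · exact h1
      · exact absurd (a.injective (h1.trans ih.symm)) h.ne
  ext z
  rw [RelIso.one_apply]
  rcases hab z with ⟨h1, -⟩ | ⟨h1, h2⟩
  · exact h1
  · by_cases hz : u z = z
    · rw [h2, hz]
    · obtain ⟨n, hn, hn'⟩ := horb z hz
      rw [zpow_succ_apply] at hn'
      have h := b.monotone hn
      rcases hab ((u ^ n) x₀) with ⟨-, h4⟩ | ⟨-, h4⟩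
      · rw [h4, h1] at h
        exact absurd h hn'.not_ge
      · exact absurd ((hfix n).symm.trans h4) (hlt n).ne

/-- A positive element whose support is covered by the translates of one fundamental interval
is unsplit. -/
lemma unsplit_of_orbit {u : Ω ≃o Ω} {x₀ : Ω} (hx₀ : x₀ < u x₀)
    (horb : ∀ z, u z ≠ z → ∃ n : ℤ, (u ^ n) x₀ ≤ z ∧ z < (u ^ (n + 1)) x₀) : Unsplit u := by
  intro a b hsup hinf
  have hab : ∀ z, a z = z ∧ b z = u z ∨ b z = z ∧ a z = u z := by
    intro z
    have h1 := (autInf_eq_one_iff a b).1 hinf z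
    have h2 : max (a z) (b z) = u z := by rw [← autSup_apply, hsup]
    rcases le_total (a z) (b z) with h | h
    · exact Or.inl ⟨by rwa [min_eq_left h] at h1, by rwa [max_eq_right h] at h2⟩
    · exact Or.inr ⟨by rwa [min_eq_right h] at h1, by rwa [max_eq_left h] at h2⟩
  rcases hab x₀ with ⟨h, -⟩ | ⟨h, -⟩
  · exact Or.inl (eq_one_of_fixes_base hx₀ horb hab h)
  · exact Or.inr (eq_one_of_fixes_base hx₀ horb (fun z => (hab z).symm) h)

end Unsplit

section Homogeneous

/-- The automorphism group acts transitively on increasing pairs. -/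
def PairHomogeneous (Ω : Type*) [LinearOrder Ω] : Prop :=
  ∀ α β γ δ : Ω, α < β → γ < δ → ∃ g : Ω ≃o Ω, g α = γ ∧ g β = δ

lemma PairHomogeneous.noMaxOrder (hom : PairHomogeneous Ω) {u : Ω ≃o Ω} {x : Ω} (hx : x < u x) :
    NoMaxOrder Ω := by
  refine ⟨fun m => ?_⟩
  by_contra! hm
  rcases (hm x).lt_or_eq with h | h
  · obtain ⟨g, hg, hg'⟩ := hom x (u x) x m hx h
    have h1 : u x = m := (hm _).antisymm (by
      rw [← g.le_iff_le, hg']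
      exact hm _)
    have h2 := u.strictMono hx
    rw [h1] at h2
    exact (hm _).not_gt h2
  · exact (hm (u x)).not_gt (h ▸ hx)

lemma PairHomogeneous.noMinOrder (hom : PairHomogeneous Ω) {u : Ω ≃o Ω} {x : Ω} (hx : x < u x) :
    NoMinOrder Ω := by
  refine ⟨fun m => ?_⟩
  by_contra! hm
  have h0 : m < u x := (hm x).trans_lt hx
  obtain ⟨g, hg, hg'⟩ := hom x (u x) m (u x) hx h0
  have h1 : x = m := by
    refine (hm x).antisymm' ?_
    rw [← g.le_iff_le, hg]
    exact hm _
  have h2 : u.symm x < x := by rwa [OrderIso.symm_apply_lt]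
  exact (hm _).not_gt (h1 ▸ h2)

lemma PairHomogeneous.denselyOrdered (hom : PairHomogeneous Ω) {u : Ω ≃o Ω} {x : Ω}
    (hx : x < u x) : DenselyOrdered Ω := by
  refine ⟨fun a b hab => ?_⟩
  have h := u.strictMono hx
  obtain ⟨g, hg, hg'⟩ := hom x (u (u x)) a b (hx.trans h) hab
  exact ⟨g (u x), hg ▸ g.strictMono hx, hg' ▸ g.strictMono h⟩

/-- Every interval supports a nontrivial positive automorphism. -/
lemma PairHomogeneous.exists_supported [DenselyOrdered Ω] (hom : PairHomogeneous Ω) {a b : Ω}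
    (hab : a < b) : ∃ k : Ω ≃o Ω, (∀ x, x ≤ k x) ∧ (∀ x, x ∉ Set.Ioo a b → k x = x) ∧
      ∃ x ∈ Set.Ioo a b, x < k x := by
  classical
  obtain ⟨p, hap, hpb⟩ := exists_between hab
  obtain ⟨q, hpq, hqb⟩ := exists_between hpb
  obtain ⟨g₁, hg₁a, hg₁p⟩ := hom a p a q hap (hap.trans hpq)
  obtain ⟨g₂, hg₂p, hg₂b⟩ := hom p b q b hpb hqb
  have hFmaps : Set.MapsTo (fun x => if x ≤ p then g₁ x else g₂ x) (Set.Ioo a b) (Set.Ioo a b) := by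
    intro x hx
    by_cases hxp : x ≤ p
    · simp only [hxp, if_true]
      exact ⟨hg₁a ▸ g₁.strictMono hx.1, (hg₁p ▸ g₁.monotone hxp).trans_lt hqb⟩
    · simp only [hxp, if_false]
      rw [not_le] at hxp
      exact ⟨(hap.trans hpq).trans (hg₂p ▸ g₂.strictMono hxp), hg₂b ▸ g₂.strictMono hx.2⟩
  have hFmono : StrictMonoOn (fun x => if x ≤ p then g₁ x else g₂ x) (Set.Ioo a b) := by
    intro x _ y _ hxy
    by_cases hyp : y ≤ p
    · simpa only [hyp, hxy.le.trans hyp, if_true] using g₁.strictMono hxy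
    · by_cases hxp : x ≤ p
      · simp only [hyp, hxp, if_true, if_false]
        rw [not_le] at hyp
        exact (hg₁p ▸ g₁.monotone hxp).trans_lt (hg₂p ▸ g₂.strictMono hyp)
      · simpa only [hyp, hxp, if_false] using g₂.strictMono hxy
  have hFsurj : Set.SurjOn (fun x => if x ≤ p then g₁ x else g₂ x)
      (Set.Ioo a b) (Set.Ioo a b) := by
    intro y hy
    by_cases hyq : y ≤ q
    · have h1 : g₁.symm y ≤ p := by rwa [OrderIso.symm_apply_le, hg₁p]
      refine ⟨g₁.symm y, ⟨?_, h1.trans_lt hpb⟩, ?_⟩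
      · rw [OrderIso.lt_symm_apply, hg₁a]
        exact hy.1
      · simp [h1]
    · rw [not_le] at hyq
      have h1 : p < g₂.symm y := by rwa [OrderIso.lt_symm_apply, hg₂p]
      refine ⟨g₂.symm y, ⟨hap.trans h1, ?_⟩, ?_⟩
      · rw [OrderIso.symm_apply_lt, hg₂b]
        exact hy.2
      · simp [h1.not_ge]
  obtain ⟨e, he, he'⟩ := exists_extend_by_id Set.ordConnected_Ioo hFmaps hFmono hFsurj
  refine ⟨autSup e 1, fun x => le_max_right _ _, fun x hx => ?_, p, ⟨hap, hpb⟩, ?_⟩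
  · rw [autSup_apply, he' x hx, RelIso.one_apply, max_self]
  · refine hpq.trans_le (le_max_of_le_left ?_)
    rw [he p ⟨hap, hpb⟩, if_pos le_rfl, hg₁p]

/-- A point between two terms of a `ℤ`-sequence lies between two consecutive terms. -/
lemma exists_le_lt_succ_of_between {x : ℤ → Ω} (hx : StrictMono x) {z : Ω} {n m : ℤ}
    (hn : x n ≤ z) (hm : z < x m) : ∃ k : ℤ, x k ≤ z ∧ z < x (k + 1) := by
  obtain ⟨k, hk, hk'⟩ := Int.exists_greatest_of_bdd (P := fun k => x k ≤ z)
    ⟨m, fun k hk => (hx.lt_iff_lt.1 (hk.trans_lt hm)).le⟩ ⟨n, hn⟩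
  refine ⟨k, hk, ?_⟩
  by_contra! h
  have := hk' _ h
  omega

/-- An automorphism shifting a prescribed `ℤ`-sequence and trivial off its convex hull. -/
lemma PairHomogeneous.exists_shift (hom : PairHomogeneous Ω) {x : ℤ → Ω} (hx : StrictMono x) :
    ∃ u : Ω ≃o Ω, (∀ n, u (x n) = x (n + 1)) ∧
      (∀ z, (∃ n, x n ≤ z ∧ z < x (n + 1)) → z < u z) ∧
      ∀ z, (¬ ∃ n, x n ≤ z ∧ z < x (n + 1)) → u z = z := by
  classical
  set D : Set Ω := {z | ∃ n, x n ≤ z ∧ z < x (n + 1)} with hD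
  have hconv : D.OrdConnected := by
    refine ⟨?_⟩
    rintro a ⟨n, hn, -⟩ b ⟨m, -, hm⟩ c hc
    exact exists_le_lt_succ_of_between hx (hn.trans hc.1) (hc.2.trans_lt hm)
  choose g hg hg' using fun n : ℤ =>
    hom (x n) (x (n + 1)) (x (n + 1)) (x (n + 1 + 1)) (hx (by omega)) (hx (by omega))
  have huniq : ∀ {z : Ω} {n m : ℤ}, x n ≤ z → z < x (m + 1) → n ≤ m := by
    intro z n m h1 h2
    have := hx.lt_iff_lt.1 (h1.trans_lt h2)
    omega
  set F : Ω → Ω := fun z => if h : ∃ n, x n ≤ z ∧ z < x (n + 1) then g h.choose z else z with hF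
  have hFeq : ∀ {z : Ω} {n : ℤ}, x n ≤ z → z < x (n + 1) → F z = g n z := by
    intro z n h1 h2
    have h : ∃ n, x n ≤ z ∧ z < x (n + 1) := ⟨n, h1, h2⟩
    have h3 : h.choose = n :=
      le_antisymm (huniq h.choose_spec.1 h2) (huniq h1 h.choose_spec.2)
    simp only [hF, dif_pos h, h3]
  have hlo : ∀ {z : Ω} {n : ℤ}, x n ≤ z → x (n + 1) ≤ g n z := fun {z n} h =>
    hg n ▸ (g n).monotone h
  have hhi : ∀ {z : Ω} {n : ℤ}, z < x (n + 1) → g n z < x (n + 1 + 1) := fun {z n} h =>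
    hg' n ▸ (g n).strictMono h
  obtain ⟨u, hu, hu'⟩ := exists_extend_by_id hconv (F := F) (by
      rintro z ⟨n, h1, h2⟩
      rw [hFeq h1 h2]
      exact ⟨n + 1, hlo h1, hhi h2⟩) (by
      rintro z ⟨n, h1, h2⟩ w ⟨m, h3, h4⟩ hzw
      rw [hFeq h1 h2, hFeq h3 h4]
      rcases (huniq h1 (hzw.trans h4)).eq_or_lt with rfl | h
      · exact (g n).strictMono hzw
      · exact (hhi h2).trans_le ((hx.monotone (by omega)).trans (hlo h3))) (by
      rintro w ⟨m, h1, h2⟩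
      obtain ⟨n, rfl⟩ : ∃ n, m = n + 1 := ⟨m - 1, by omega⟩
      have h3 : x n ≤ (g n).symm w := by rwa [OrderIso.le_symm_apply, hg]
      have h4 : (g n).symm w < x (n + 1) := by rwa [OrderIso.symm_apply_lt, hg']
      exact ⟨(g n).symm w, ⟨n, h3, h4⟩, by rw [hFeq h3 h4, OrderIso.apply_symm_apply]⟩)
  refine ⟨u, fun n => ?_, ?_, fun z hz => hu' z hz⟩
  · have h1 : x n < x (n + 1) := hx (by omega)
    rw [hu _ ⟨n, le_rfl, h1⟩, hFeq le_rfl h1, hg]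
  · rintro z ⟨n, h1, h2⟩
    rw [hu z ⟨n, h1, h2⟩, hFeq h1 h2]
    exact h2.trans_le (hlo h1)

/-- In a separable pair-homogeneous order, every open convex set is the support of a
positive unsplit element. -/
lemma PairHomogeneous.exists_unsplit (hom : PairHomogeneous Ω) {S : Set Ω} (hS : S.Countable)
    (hSd : ∀ a b : Ω, a < b → ∃ s ∈ S, a < s ∧ s < b) {D : Set Ω} (hD : D.OrdConnected)
    (hne : D.Nonempty) (hmax : ∀ z ∈ D, ∃ w ∈ D, z < w) (hmin : ∀ z ∈ D, ∃ w ∈ D, w < z) :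
    ∃ u : Ω ≃o Ω, (∀ z, z ≤ u z) ∧ Unsplit u ∧ ∀ z, u z ≠ z ↔ z ∈ D := by
  set T : Set Ω := S ∩ D with hT
  have hbtw : ∀ a ∈ D, ∀ b ∈ D, a < b → ∃ t ∈ T, a < t ∧ t < b := by
    intro a ha b hb hab
    obtain ⟨s, hs, h1, h2⟩ := hSd a b hab
    exact ⟨s, ⟨hs, hD.out ha hb ⟨h1.le, h2.le⟩⟩, h1, h2⟩
  have hup : ∀ z ∈ D, ∃ t ∈ T, z < t := by
    intro z hz
    obtain ⟨w, hw, hzw⟩ := hmax z hz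
    obtain ⟨t, ht, h, -⟩ := hbtw z hz w hw hzw
    exact ⟨t, ht, h⟩
  have hdown : ∀ z ∈ D, ∃ t ∈ T, t < z := by
    intro z hz
    obtain ⟨w, hw, hzw⟩ := hmin z hz
    obtain ⟨t, ht, -, h⟩ := hbtw w hw z hz hzw
    exact ⟨t, ht, h⟩
  have : Countable T := (hS.mono Set.inter_subset_left).to_subtype
  have : Nonempty T := by
    obtain ⟨z, hz⟩ := hne
    obtain ⟨t, ht, -⟩ := hup z hz
    exact ⟨⟨t, ht⟩⟩
  have : NoMaxOrder T := ⟨fun a => by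
    obtain ⟨t, ht, h⟩ := hup a a.2.2
    exact ⟨⟨t, ht⟩, h⟩⟩
  have : NoMinOrder T := ⟨fun a => by
    obtain ⟨t, ht, h⟩ := hdown a a.2.2
    exact ⟨⟨t, ht⟩, h⟩⟩
  have : DenselyOrdered T := ⟨fun a b hab => by
    obtain ⟨t, ht, h, h'⟩ := hbtw a a.2.2 b b.2.2 hab
    exact ⟨⟨t, ht⟩, h, h'⟩⟩
  obtain ⟨e⟩ := Order.iso_of_countable_dense ℚ T
  have hx : StrictMono fun n : ℤ => (e (n : ℚ) : Ω) := fun n m hnm =>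
    e.strictMono (Int.cast_lt.2 hnm)
  obtain ⟨u, hshift, hin, hout⟩ := hom.exists_shift hx
  have hmem : ∀ z, (∃ n : ℤ, (e (n : ℚ) : Ω) ≤ z ∧ z < e ((n + 1 : ℤ) : ℚ)) ↔ z ∈ D := by
    intro z
    constructor
    · rintro ⟨n, h1, h2⟩
      exact hD.out (e (n : ℚ)).2.2 (e ((n + 1 : ℤ) : ℚ)).2.2 ⟨h1, h2.le⟩
    · intro hz
      obtain ⟨s, hs, hsz⟩ := hdown z hz
      obtain ⟨t, ht, hzt⟩ := hup z hz
      refine exists_le_lt_succ_of_between hx (n := ⌊e.symm ⟨s, hs⟩⌋) (m := ⌈e.symm ⟨t, ht⟩⌉) ?_ ?_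
      · have h : e ((⌊e.symm ⟨s, hs⟩⌋ : ℤ) : ℚ) ≤ ⟨s, hs⟩ := by
          rw [← OrderIso.le_symm_apply]
          exact Int.floor_le _
        exact le_trans (Subtype.coe_le_coe.2 h) hsz.le
      · have h : ⟨t, ht⟩ ≤ e ((⌈e.symm ⟨t, ht⟩⌉ : ℤ) : ℚ) := by
          rw [← OrderIso.symm_apply_le]
          exact Int.le_ceil _
        exact lt_of_lt_of_le hzt (Subtype.coe_le_coe.2 h)
  have hsupp : ∀ z, u z ≠ z ↔ z ∈ D := by
    intro z
    rw [← hmem]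
    exact ⟨fun h => by_contra fun h' => h (hout z h'), fun h => (hin z h).ne'⟩
  have hle : ∀ z, z ≤ u z := by
    intro z
    by_cases h : u z = z
    · exact h.ge
    · exact (hin z ((hmem z).2 ((hsupp z).1 h))).le
  have hpow : ∀ n : ℤ, (u ^ n) (e ((0 : ℤ) : ℚ)) = (e (n : ℚ) : Ω) := by
    intro n
    induction n using Int.induction_on with
    | zero => simp
    | succ n ih => rw [zpow_succ_apply, ih, hshift]
    | pred n ih =>
      apply u.injective
      rw [← zpow_succ_apply, sub_add_cancel, ih, hshift, sub_add_cancel]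
  refine ⟨u, hle, unsplit_of_orbit (x₀ := e ((0 : ℤ) : ℚ)) ?_ ?_, hsupp⟩
  · exact hin _ ⟨0, le_rfl, hx (by norm_num)⟩
  · intro z hz
    simp only [hpow]
    exact (hmem z).2 ((hsupp z).1 hz)

end Homogeneous

section Separable

lemma pow_apply_le_pow_apply {a b : Ω ≃o Ω} (h : ∀ x, a x ≤ b x) (n : ℕ) (x : Ω) :
    (a ^ n) x ≤ (b ^ n) x := by
  induction n with
  | zero => simp
  | succ n ih =>
    rw [pow_succ', pow_succ', RelIso.mul_apply, RelIso.mul_apply]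
    exact (h _).trans (b.monotone ih)

/-- An unsplit positive element disjoint from no nontrivial element moves every point. -/
lemma PairHomogeneous.apply_ne_self [DenselyOrdered Ω] [NoMinOrder Ω] [NoMaxOrder Ω]
    (hom : PairHomogeneous Ω) {h : Ω ≃o Ω} (hle : ∀ x, x ≤ h x) (hne : h ≠ 1) (hs : Unsplit h)
    (hfull : ∀ k : Ω ≃o Ω, autInf k h = 1 → k = 1) (y : Ω) : h y ≠ y := by
  intro hy
  obtain ⟨x, hx⟩ := (ne_one_iff_exists h).1 hne
  have key : ∀ a b : Ω, a < b → ¬ ∀ z ∈ Set.Ioo a b, h z = z := by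
    intro a b hab hfix
    obtain ⟨k, hk, hkout, z, -, hz⟩ := hom.exists_supported hab
    have h1 := hfull k ((autInf_eq_one_iff_of_one_le hle k).2 fun w =>
      ⟨hk w, fun hw => hkout w fun hw' => hw (hfix w hw')⟩)
    rw [h1, RelIso.one_apply] at hz
    exact lt_irrefl _ hz
  rcases lt_trichotomy y x with h1 | rfl | h1
  · obtain ⟨a, ha⟩ := exists_lt y
    refine key a y ha fun z hz => ?_
    by_contra hz'
    obtain ⟨-, m, -, hm⟩ := hs.exists_zpow_le_le hle hz' hx
    have h2 : (h ^ m) z ≤ y := by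
      rw [← zpow_apply_eq_self hy m]
      exact (h ^ m).monotone hz.2.le
    exact h1.not_ge (hm.trans h2)
  · exact hx hy
  · obtain ⟨b, hb⟩ := exists_gt y
    refine key y b hb fun z hz => ?_
    by_contra hz'
    obtain ⟨n, -, hn, -⟩ := hs.exists_zpow_le_le hle hz' hx
    have h2 : y ≤ (h ^ n) z := by
      conv_lhs => rw [← zpow_apply_eq_self hy n]
      exact (h ^ n).monotone hz.1.le
    exact h1.not_ge (h2.trans hn)

/-- A small centralizer yields a countable order-dense subset. -/
lemma PairHomogeneous.exists_countable_dense [DenselyOrdered Ω] [NoMinOrder Ω] [NoMaxOrder Ω]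
    [Nonempty Ω] (hom : PairHomogeneous Ω) (hc : HasSmallCentralizer Ω) :
    ∃ S : Set Ω, S.Countable ∧ ∀ a b : Ω, a < b → ∃ s ∈ S, a < s ∧ s < b := by
  obtain ⟨f, g, hf, hcent, hsmall⟩ := hc
  have hle : ∀ {h : Ω ≃o Ω}, PosCent f g h → ∀ x, x ≤ h x := fun {h} hh =>
    (autSup_one_eq_iff h).1 hh.2.2.1
  have hne : ∀ {h : Ω ≃o Ω}, PosCent f g h → ∀ x, h x ≠ x := fun {h} hh =>
    hom.apply_ne_self (hle hh) hh.2.2.2 (hcent h hh).1 (hcent h hh).2.1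
  have hlt : ∀ {h : Ω ≃o Ω}, PosCent f g h → ∀ x, x < h x := fun {h} hh x =>
    (hle hh x).lt_of_ne' (hne hh x)
  have harch : ∀ {h : Ω ≃o Ω}, PosCent f g h → ∀ x y,
      ∃ n m : ℤ, (h ^ n) x ≤ y ∧ y ≤ (h ^ m) x := fun {h} hh x y =>
    (hcent h hh).1.exists_zpow_le_le (hle hh) (hne hh x) (hne hh y)
  have hhalf : ∀ h : {h : Ω ≃o Ω // PosCent f g h}, ∃ k : {h : Ω ≃o Ω // PosCent f g h},
      ∀ x, (k.1 * k.1) x ≤ h.1 x := by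
    rintro ⟨h, hh⟩
    obtain ⟨k, hk, hkh⟩ := (hcent h hh).2.2.1
    exact ⟨⟨k, hk⟩, (autSup_eq_right_iff _ _).1 hkh⟩
  choose half hhalf using hhalf
  set t : ℕ → {h : Ω ≃o Ω // PosCent f g h} := fun n => half^[n] ⟨f, hf⟩ with ht
  have htsucc : ∀ n x, ((t (n + 1)).1 * (t (n + 1)).1) x ≤ (t n).1 x := by
    intro n x
    simp only [ht, Function.iterate_succ_apply']
    exact hhalf _ x
  have htpow : ∀ n x, ((t n).1 ^ (2 ^ n)) x ≤ f x := by
    intro n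
    induction n with
    | zero => intro x; simp [ht]
    | succ n ih =>
      intro x
      rw [pow_succ', pow_mul, pow_two]
      exact (pow_apply_le_pow_apply (htsucc n) _ x).trans (ih x)
  have htsmall : ∀ k : Ω ≃o Ω, PosCent f g k → ∃ n, ∀ x, (t n).1 x ≤ k x := by
    intro k hk
    by_contra! hcon
    obtain ⟨x⟩ := ‹Nonempty Ω›
    obtain ⟨-, m, -, hm⟩ := harch hk x (f (f x))
    have hkt : ∀ n x, k x ≤ (t n).1 x := by
      intro n
      rcases (hcent k hk).2.2.2 _ (t n).2 with h | h
      · exact (autSup_eq_right_iff _ _).1 h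
      · obtain ⟨y, hy⟩ := hcon n
        exact absurd ((autSup_eq_right_iff _ _).1 h y) hy.not_ge
    set n := m.toNat with hn
    have h1 : (k ^ m) x ≤ (k ^ ((2 ^ n : ℕ) : ℤ)) x := by
      refine zpow_apply_mono (hle hk) x ?_
      have h2 : n < 2 ^ n := Nat.lt_two_pow_self
      have h3 : m ≤ n := Int.self_le_toNat m
      exact h3.trans (by exact_mod_cast h2.le)
    rw [zpow_natCast] at h1
    have h2 := (h1.trans (pow_apply_le_pow_apply (hkt n) _ x)).trans (htpow n x)
    exact (hm.trans h2).not_gt (hlt hf (f x))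
  obtain ⟨x₀⟩ := ‹Nonempty Ω›
  refine ⟨Set.range fun p : ℕ × ℤ => ((t p.1).1 ^ p.2) x₀, Set.countable_range _, ?_⟩
  intro a b hab
  obtain ⟨k, hk, hkout, z, hzab, hz⟩ := hom.exists_supported hab
  obtain ⟨H, hH, hkH⟩ := hsmall k ((autSup_one_eq_iff k).2 hk)
    ((ne_one_iff_exists k).2 ⟨z, hz.ne'⟩)
  have : ∃ x, H x < k x := by
    by_contra! h
    exact hkH ((autSup_eq_right_iff _ _).2 h)
  obtain ⟨x, hx⟩ := this
  have hxab : x ∈ Set.Ioo a b := by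
    by_contra h
    rw [hkout x h] at hx
    exact (hle hH x).not_gt hx
  have hHb : H x < b := by
    have h1 : k b = b := hkout b fun h => lt_irrefl _ h.2
    exact hx.trans (h1 ▸ k.strictMono hxab.2)
  obtain ⟨n, hn⟩ := htsmall H hH
  have htn := (t n).2
  have hmono : StrictMono fun m : ℤ => ((t n).1 ^ m) x₀ :=
    strictMono_int_of_lt_succ fun m => by
      rw [zpow_succ_apply]
      exact hlt htn _
  obtain ⟨i, -, hi, -⟩ := harch htn x₀ x
  obtain ⟨-, j, -, hj⟩ := harch htn x₀ ((t n).1 x)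
  obtain ⟨m, hm, hm'⟩ := exists_le_lt_succ_of_between hmono hi ((hlt htn x).trans_le hj)
  refine ⟨_, ⟨(n, m + 1), rfl⟩, hxab.1.trans hm', ?_⟩
  simp only [zpow_succ_apply]
  exact (((t n).1.monotone hm).trans (hn x)).trans_lt hHb

end Separable

section Complete

lemma PairHomogeneous.isBump [NoMaxOrder Ω] (hom : PairHomogeneous Ω) {u : Ω ≃o Ω}
    (hu : ∀ z, z ≤ u z) (hs : Unsplit u) (hne : ∃ z, u z ≠ z) {x y : Ω} (hxy : x < y)
    (hsupp : ∀ z, u z ≠ z → z ∈ Set.Ioo x y) : IsBump u := by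
  obtain ⟨y', hy'⟩ := exists_gt y
  obtain ⟨h, hx, -⟩ := hom x y y y' hxy hy'
  refine ⟨(autSup_one_eq_iff u).2 hu, (ne_one_iff_exists u).2 hne, hs, h, ?_⟩
  refine (autInf_eq_one_iff_of_one_le (conj_one_le hu h) u).2 fun z => ⟨hu z, fun hz => ?_⟩
  have h1 := (hsupp _ ((conj_apply_ne_iff u h z).1 hz)).1
  rw [OrderIso.lt_symm_apply, hx] at h1
  by_contra hz'
  exact lt_asymm h1 (hsupp z hz').2

/-- Conjugacy of bumps up to disjointness forces Dedekind completeness. -/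
lemma PairHomogeneous.exists_isLUB [DenselyOrdered Ω] [NoMaxOrder Ω]
    (hom : PairHomogeneous Ω) (hb : BumpsPolarConj Ω) {S : Set Ω} (hS : S.Countable)
    (hSd : ∀ a b : Ω, a < b → ∃ s ∈ S, a < s ∧ s < b) {L : Set Ω} (hL : L.Nonempty)
    (hLb : BddAbove L) : ∃ z, IsLUB L z := by
  by_contra! hno
  obtain ⟨x, hx⟩ := hL
  obtain ⟨y, hy⟩ := hLb
  have hmin : ∀ z ∈ upperBounds L, ∃ w ∈ upperBounds L, w < z := by
    intro z hz
    by_contra! h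
    exact hno z ⟨hz, h⟩
  have hdisj : ∀ z ∈ L, z ∉ upperBounds L := fun z hz hz' => hno z ⟨hz', fun w hw => hw hz⟩
  have hupper : ∀ {z w : Ω}, z ∈ upperBounds L → z ≤ w → w ∈ upperBounds L :=
    fun hz hzw l hl => (hz hl).trans hzw
  have hmax : ∀ z, z ∉ upperBounds L → ∃ w, w ∉ upperBounds L ∧ z < w := by
    intro z hz
    simp only [mem_upperBounds, not_forall, not_le] at hz
    obtain ⟨l, hl, hzl⟩ := hz
    exact ⟨l, hdisj l hl, hzl⟩
  have hxU : ∀ z ∈ upperBounds L, x < z := fun z hz =>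
    (hz hx).lt_of_ne fun h => hdisj x hx (h ▸ hz)
  have hxy : x < y := hxU y hy
  obtain ⟨y₁, hy₁, hy₁y⟩ := hmin y hy
  obtain ⟨u, hu, hus, husupp⟩ := hom.exists_unsplit hS hSd (D := {z | z ∈ upperBounds L ∧ z < y})
    ⟨fun a ha b hb c hc => ⟨hupper ha.1 hc.1, hc.2.trans_lt hb.2⟩⟩ ⟨y₁, hy₁, hy₁y⟩
    (fun z hz => by
      obtain ⟨w, h1, h2⟩ := exists_between hz.2
      exact ⟨w, ⟨hupper hz.1 h1.le, h2⟩, h1⟩)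
    (fun z hz => by
      obtain ⟨w, h1, h2⟩ := hmin z hz.1
      exact ⟨w, ⟨h1, h2.trans hz.2⟩, h2⟩)
  obtain ⟨v, hv, hvs, hvsupp⟩ := hom.exists_unsplit hS hSd (D := Set.Ioo x y)
    Set.ordConnected_Ioo (Set.nonempty_Ioo.2 hxy)
    (fun z hz => by
      obtain ⟨w, h1, h2⟩ := exists_between hz.2
      exact ⟨w, ⟨hz.1.trans h1, h2⟩, h1⟩)
    (fun z hz => by
      obtain ⟨w, h1, h2⟩ := exists_between hz.1
      exact ⟨w, ⟨h1, h2.trans hz.2⟩, h2⟩)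
  obtain ⟨h, hh⟩ := hb u v
    (hom.isBump hu hus ⟨y₁, (husupp _).2 ⟨hy₁, hy₁y⟩⟩ hxy fun z hz =>
      ⟨hxU z ((husupp z).1 hz).1, ((husupp z).1 hz).2⟩)
    (hom.isBump hv hvs (by
      obtain ⟨w, hw⟩ := Set.nonempty_Ioo.2 hxy
      exact ⟨w, (hvsupp w).2 hw⟩) hxy fun z hz => (hvsupp z).1 hz)
  simp only [autInf_eq_one_iff_of_one_le hv, autInf_eq_one_iff_of_one_le (conj_one_le hu h),
    conj_apply_ne_iff, husupp, hvsupp] at hh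
  set z := h.symm x with hz
  have hhz : h z = x := h.apply_symm_apply x
  by_cases hzU : z ∈ upperBounds L
  · obtain ⟨w, hw, hwz⟩ := hmin (min z y) (by
      rcases min_choice z y with h | h <;> rw [h] <;> assumption)
    obtain ⟨k, hk, hkout, p, hp, hkp⟩ := hom.exists_supported (h.strictMono hwz)
    refine hkp.ne' ((((hh k).2 fun q => ⟨hk q, fun hq => hkout q fun hq' => ?_⟩) p).2 ?_)
    · refine lt_asymm hq.1 (hq'.2.trans_le ?_)
      rw [← hhz]
      exact h.monotone (min_le_left _ _)
    · have h1 := h.lt_symm_apply.2 hp.1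
      have h2 := h.symm_apply_lt.2 hp.2
      exact ⟨hupper hw h1.le, h2.trans_le (min_le_right _ _)⟩
  · obtain ⟨w, hw, hzw⟩ := hmax z hzU
    have h0 : x < min (h w) y := lt_min (hhz ▸ h.strictMono hzw) hxy
    obtain ⟨k, hk, hkout, p, hp, hkp⟩ := hom.exists_supported h0
    refine hkp.ne' ((((hh k).1 fun q => ⟨hk q, fun hq => hkout q fun hq' => ?_⟩) p).2 ?_)
    · exact hw (hupper hq.1 (h.symm_apply_le.2 (hq'.2.le.trans (min_le_left _ _))))
    · exact ⟨hp.1, hp.2.trans_le (min_le_right _ _)⟩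

end Complete

section RealLine

/-- A separable Dedekind complete dense order without endpoints is the real line. -/
lemma nonempty_orderIso_real [NoMinOrder Ω] [NoMaxOrder Ω] [Nonempty Ω] {S : Set Ω}
    (hS : S.Countable) (hSd : ∀ a b : Ω, a < b → ∃ s ∈ S, a < s ∧ s < b)
    (hlub : ∀ L : Set Ω, L.Nonempty → BddAbove L → ∃ z, IsLUB L z) : Nonempty (Ω ≃o ℝ) := by
  have hup : ∀ z : Ω, ∃ s : S, z < s := fun z => by
    obtain ⟨w, hw⟩ := exists_gt z
    obtain ⟨s, hs, h, -⟩ := hSd z w hw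
    exact ⟨⟨s, hs⟩, h⟩
  have hdown : ∀ z : Ω, ∃ s : S, s < z := fun z => by
    obtain ⟨w, hw⟩ := exists_lt z
    obtain ⟨s, hs, -, h⟩ := hSd w z hw
    exact ⟨⟨s, hs⟩, h⟩
  have : Countable S := hS.to_subtype
  have : Nonempty S := (hup (Classical.arbitrary Ω)).nonempty
  have : NoMaxOrder S := ⟨fun a => hup a⟩
  have : NoMinOrder S := ⟨fun a => hdown a⟩
  have : DenselyOrdered S := ⟨fun a b hab => by
    obtain ⟨t, ht, h, h'⟩ := hSd a b hab
    exact ⟨⟨t, ht⟩, h, h'⟩⟩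
  obtain ⟨e⟩ := Order.iso_of_countable_dense S ℚ
  set A : Ω → Set ℝ := fun z => (fun s : S => (e s : ℝ)) '' {s | (s : Ω) ≤ z} with hA
  have hAub : ∀ {z : Ω} {t : S}, z ≤ t → (e t : ℝ) ∈ upperBounds (A z) := by
    rintro z t hzt _ ⟨s, hs, rfl⟩
    exact Rat.cast_le.2 (e.monotone (Subtype.coe_le_coe.1 (le_trans hs hzt)))
  have hAne : ∀ z, (A z).Nonempty := fun z => by
    obtain ⟨s, hs⟩ := hdown z
    exact ⟨_, s, hs.le, rfl⟩
  have hAbdd : ∀ z, BddAbove (A z) := fun z => by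
    obtain ⟨s, hs⟩ := hup z
    exact ⟨_, hAub hs.le⟩
  have hle : ∀ {z : Ω} {s : S}, (s : Ω) ≤ z → (e s : ℝ) ≤ sSup (A z) := fun {z s} hs =>
    le_csSup (hAbdd z) ⟨s, hs, rfl⟩
  have hmono : StrictMono fun z => sSup (A z) := by
    intro z w hzw
    obtain ⟨t, ht, hzt, htw⟩ := hSd z w hzw
    obtain ⟨s, hs, hzs, hst⟩ := hSd z t hzt
    calc sSup (A z) ≤ e ⟨s, hs⟩ := csSup_le (hAne z) (hAub hzs.le)
      _ < e ⟨t, ht⟩ := Rat.cast_lt.2 (e.strictMono hst)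
      _ ≤ sSup (A w) := hle htw.le
  have hsurj : Function.Surjective fun z => sSup (A z) := by
    intro r
    set L : Set Ω := Subtype.val '' {s : S | (e s : ℝ) < r} with hL
    have hLub : ∀ {q : ℚ}, r ≤ q → (e.symm q : Ω) ∈ upperBounds L := by
      rintro q hq _ ⟨s, hs, rfl⟩
      refine Subtype.coe_le_coe.2 (e.le_symm_apply.2 ?_)
      exact_mod_cast (lt_of_lt_of_le hs hq).le
    have hmem : ∀ {q : ℚ}, (q : ℝ) < r → (e.symm q : Ω) ∈ L := fun {q} hq =>
      ⟨e.symm q, by simpa using hq, rfl⟩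
    obtain ⟨q₁, hq₁⟩ := exists_rat_lt r
    obtain ⟨q₂, hq₂⟩ := exists_rat_gt r
    obtain ⟨z, hz⟩ := hlub L ⟨_, hmem hq₁⟩ ⟨_, hLub hq₂.le⟩
    refine ⟨z, le_antisymm (csSup_le (hAne z) ?_) ?_⟩
    · rintro _ ⟨s, hs, rfl⟩
      by_contra! h
      obtain ⟨q, hq, hqs⟩ := exists_rat_btwn h
      have h1 : (e.symm q : Ω) < s := Subtype.coe_lt_coe.2 (e.symm_apply_lt.2 (Rat.cast_lt.1 hqs))
      exact ((hz.2 (hLub hq.le)).trans_lt h1).not_ge hs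
    · by_contra! h
      obtain ⟨q, hq, hqr⟩ := exists_rat_btwn h
      have h1 := hle (hz.1 (hmem hqr))
      rw [e.apply_symm_apply] at h1
      exact hq.not_ge h1
  exact ⟨StrictMono.orderIsoOfSurjective _ hmono hsurj⟩

end RealLine

section RealSentences

lemma pairHomogeneous_real : PairHomogeneous ℝ := by
  intro a b c d hab hcd
  have h : 0 < (d - c) / (b - a) := div_pos (sub_pos.2 hcd) (sub_pos.2 hab)
  refine ⟨((OrderIso.addRight (-a)).trans (OrderIso.mulRight₀ _ h)).trans (OrderIso.addRight c),
    ?_, ?_⟩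
  · simp
  · have h' : b - a ≠ 0 := (sub_pos.2 hab).ne'
    simp only [OrderIso.trans_apply, OrderIso.addRight_apply, OrderIso.mulRight₀_apply]
    field_simp
    ring

/-- The support of a bump of the real line is a bounded open interval. -/
lemma IsBump.exists_support_eq_Ioo {u : ℝ ≃o ℝ} (hu : IsBump u) :
    ∃ a b : ℝ, a < b ∧ ∀ z, u z ≠ z ↔ z ∈ Set.Ioo a b := by
  obtain ⟨h1, hne, hs, h, hdisj⟩ := hu
  have hle := (autSup_one_eq_iff u).1 h1
  have hd := (autInf_eq_one_iff_of_one_le (conj_one_le hle h) u).1 hdisj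
  obtain ⟨x, hx⟩ := (ne_one_iff_exists u).1 hne
  have hconv : ∀ {p y q : ℝ}, u p ≠ p → u q ≠ q → p ≤ y → y ≤ q → u y ≠ y := by
    intro p y q hp hq hpy hyq hy
    obtain ⟨-, m, -, hm⟩ := hs.exists_zpow_le_le hle hp hq
    have h2 := hm.trans ((u ^ m).monotone hpy)
    rw [zpow_apply_eq_self hy] at h2
    exact hq (le_antisymm h2 hyq ▸ hy)
  have hup : u (h x) = h x :=
    (hd (h x)).2 ((conj_apply_ne_iff u h _).2 (by rwa [h.symm_apply_apply]))
  have hdown : u (h.symm x) = h.symm x := by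
    by_contra hc
    exact hx ((hd x).2 ((conj_apply_ne_iff u h x).2 hc))
  have hbd : ∃ p q, u p = p ∧ u q = q ∧ p < x ∧ x < q := by
    rcases lt_trichotomy x (h x) with h3 | h3 | h3
    · exact ⟨_, _, hdown, hup, h.symm_apply_lt.2 h3, h3⟩
    · exact absurd (h3 ▸ hup) hx
    · exact ⟨_, _, hup, hdown, h3, h.lt_symm_apply.2 h3⟩
  obtain ⟨p, q, hp, hq, hpx, hxq⟩ := hbd
  have hbelow : BddBelow {z | u z ≠ z} :=
    ⟨p, fun z hz => le_of_not_gt fun hzp => hconv hz hx hzp.le hpx.le hp⟩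
  have habove : BddAbove {z | u z ≠ z} :=
    ⟨q, fun z hz => le_of_not_gt fun hzq => hconv hx hz hxq.le hzq.le hq⟩
  have hsub : ∀ z, u z ≠ z → z ∈ Set.Ioo (sInf {z | u z ≠ z}) (sSup {z | u z ≠ z}) := by
    intro z hz
    have hlt : z < u z := (hle z).lt_of_ne' hz
    refine ⟨(csInf_le hbelow ?_).trans_lt (u.symm_apply_lt.2 hlt), hlt.trans_le (le_csSup habove ?_)⟩
    · intro hc
      rw [u.apply_symm_apply] at hc
      exact hlt.ne' (u.eq_symm_apply.1 hc)
    · exact fun hc => hz (u.injective hc)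
  refine ⟨_, _, (hsub x hx).1.trans (hsub x hx).2, fun z => ⟨hsub z, fun hz => ?_⟩⟩
  obtain ⟨r, hr, hrz⟩ := exists_lt_of_csInf_lt ⟨x, hx⟩ hz.1
  obtain ⟨s, hs', hzs⟩ := exists_lt_of_lt_csSup ⟨x, hx⟩ hz.2
  exact hconv hr hs' hrz.le hzs.le

lemma bumpsPolarConj_real : BumpsPolarConj ℝ := by
  intro u v hu hv
  obtain ⟨a, b, hab, hu'⟩ := hu.exists_support_eq_Ioo
  obtain ⟨c, d, hcd, hv'⟩ := hv.exists_support_eq_Ioo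
  obtain ⟨h, hac, hbd⟩ := pairHomogeneous_real a b c d hab hcd
  refine ⟨h, fun k => ?_⟩
  rw [autInf_eq_one_iff_of_one_le (conj_one_le ((autSup_one_eq_iff u).1 hu.1) h),
    autInf_eq_one_iff_of_one_le ((autSup_one_eq_iff v).1 hv.1)]
  simp only [conj_apply_ne_iff, hu', hv', Set.mem_Ioo, h.lt_symm_apply, h.symm_apply_lt, hac, hbd]

/-- An order automorphism commuting with two rationally independent translations is a translation. -/
lemma eq_addRight_of_commute {h : ℝ ≃o ℝ} (h1 : h * OrderIso.addRight 1 = OrderIso.addRight 1 * h)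
    (h2 : h * OrderIso.addRight √2 = OrderIso.addRight √2 * h) :
    h = OrderIso.addRight (h 0) := by
  have key : ∀ r ∈ AddSubgroup.closure {1, √2}, ∀ x, h (x + r) = h x + r := by
    intro r hr
    induction hr using AddSubgroup.closure_induction with
    | mem r hr =>
      intro x
      rcases hr with rfl | rfl
      · exact DFunLike.congr_fun h1 x
      · exact DFunLike.congr_fun h2 x
    | zero => simp
    | add r s _ _ hr hs =>
      intro x
      rw [← add_assoc, hs, hr, add_assoc]
    | neg r _ hr =>
      intro x
      have := hr (x + -r)
      rw [neg_add_cancel_right] at this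
      rw [this, add_neg_cancel_right]
  have hdense : Dense (AddSubgroup.closure {1, √2} : Set ℝ) := by
    rw [dense_addSubgroupClosure_pair_iff, one_div, irrational_inv_iff]
    exact irrational_sqrt_two
  ext x
  rw [OrderIso.addRight_apply]
  apply le_antisymm
  · by_contra! hlt
    obtain ⟨r, hr, hr1, hr2⟩ := hdense.exists_between (show x < h x - h 0 by linarith)
    have h3 := key r hr 0
    rw [zero_add] at h3
    have h4 := h.strictMono hr1
    linarith
  · by_contra! hlt
    obtain ⟨r, hr, hr1, hr2⟩ := hdense.exists_between (show h x - h 0 < x by linarith)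
    have h3 := key r hr 0
    rw [zero_add] at h3
    have h4 := h.strictMono hr2
    linarith

lemma posCent_addRight {a : ℝ} (ha : 0 < a) :
    PosCent (OrderIso.addRight (1 : ℝ)) (OrderIso.addRight √2) (OrderIso.addRight a) := by
  refine ⟨?_, ?_, (autSup_one_eq_iff _).2 fun x => ?_, (ne_one_iff_exists _).2 ⟨0, ?_⟩⟩
  · ext x
    exact add_right_comm x 1 a
  · ext x
    exact add_right_comm x (√2) a
  · simpa using ha.le
  · simpa using ha.ne'

lemma PosCent.exists_eq_addRight {h : ℝ ≃o ℝ}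
    (hh : PosCent (OrderIso.addRight (1 : ℝ)) (OrderIso.addRight √2) h) :
    ∃ a : ℝ, 0 < a ∧ h = OrderIso.addRight a := by
  obtain ⟨h1, h2, h3, h4⟩ := hh
  have h5 := eq_addRight_of_commute h1 h2
  refine ⟨h 0, ((autSup_one_eq_iff h).1 h3 0).lt_of_ne fun h0 => h4 ?_, h5⟩
  rw [h5, ← h0]
  ext x
  exact add_zero x

lemma addRight_zpow_apply (a : ℝ) (n : ℤ) (x : ℝ) :
    ((OrderIso.addRight a : ℝ ≃o ℝ) ^ n) x = x + n * a := by
  induction n using Int.induction_on with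
  | zero => simp
  | succ n ih =>
    rw [zpow_succ_apply, ih, OrderIso.addRight_apply]
    push_cast
    ring
  | pred n ih =>
    apply (OrderIso.addRight a).injective
    rw [← zpow_succ_apply, sub_add_cancel, ih, OrderIso.addRight_apply]
    push_cast
    ring

lemma unsplit_addRight {a : ℝ} (ha : 0 < a) : Unsplit (OrderIso.addRight a) := by
  refine unsplit_of_orbit (x₀ := 0) (by simpa using ha) fun z _ => ⟨⌊z / a⌋, ?_, ?_⟩
  · rw [addRight_zpow_apply, zero_add]
    exact (le_div_iff₀ ha).1 (Int.floor_le _)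
  · rw [addRight_zpow_apply, zero_add, ← div_lt_iff₀ ha]
    push_cast
    exact Int.lt_floor_add_one _

lemma hasSmallCentralizer_real : HasSmallCentralizer ℝ := by
  refine ⟨OrderIso.addRight 1, OrderIso.addRight √2, posCent_addRight one_pos, fun h hh => ?_,
    fun u hu hne => ?_⟩
  · obtain ⟨a, ha, rfl⟩ := hh.exists_eq_addRight
    refine ⟨unsplit_addRight ha, fun k hk => ?_, ⟨_, posCent_addRight (half_pos ha), ?_⟩,
      fun k hk => ?_⟩
    · ext x
      exact ((autInf_eq_one_iff_of_one_le ((autSup_one_eq_iff _).1 hh.2.2.1) k).1 hk x).2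
        (by simpa using ha.ne')
    · refine (autSup_eq_right_iff _ _).2 fun x => ?_
      simp only [RelIso.mul_apply, OrderIso.addRight_apply]
      linarith
    · obtain ⟨b, hb, rfl⟩ := hk.exists_eq_addRight
      simp only [autSup_eq_right_iff, OrderIso.addRight_apply, add_le_add_iff_left, forall_const]
      exact le_total a b
  · obtain ⟨x, hx⟩ := (ne_one_iff_exists u).1 hne
    have hlt : x < u x := ((autSup_one_eq_iff u).1 hu x).lt_of_ne' hx
    refine ⟨_, posCent_addRight (half_pos (sub_pos.2 hlt)), fun h => ?_⟩
    have h1 := (autSup_eq_right_iff _ _).1 h x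
    rw [OrderIso.addRight_apply] at h1
    linarith

end RealSentences

/-- If `Aut(Ω,≤)` acts transitively on pairs `α < β` and is
elementarily equivalent to `Aut(ℝ,≤)` in the first-order language of
lattice-ordered groups, then `Ω ≅ ℝ` as ordered sets. -/
theorem gurevich_holland (Ω : Type*) [LinearOrder Ω]
    (htrans : ∀ α β γ δ : Ω, α < β → γ < δ → ∃ g : Ω ≃o Ω, g α = γ ∧ g β = δ)
    (heq : LGLang.ElementarilyEquivalent (Ω ≃o Ω) (ℝ ≃o ℝ)) :
    Nonempty (Ω ≃o ℝ) := by
  have hom : PairHomogeneous Ω := htrans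
  have hc : HasSmallCentralizer Ω := by
    rw [← realize_smallCentralizerSentence, heq.realize_sentence, realize_smallCentralizerSentence]
    exact hasSmallCentralizer_real
  have hb : BumpsPolarConj Ω := by
    rw [← realize_bumpsPolarConjSentence, heq.realize_sentence, realize_bumpsPolarConjSentence]
    exact bumpsPolarConj_real
  obtain ⟨f, g, hf, -⟩ := id hc
  obtain ⟨x, hx⟩ := (ne_one_iff_exists f).1 hf.2.2.2
  have hlt : x < f x := ((autSup_one_eq_iff f).1 hf.2.2.1 x).lt_of_ne' hx
  have := hom.noMaxOrder hlt
  have := hom.noMinOrder hlt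
  have := hom.denselyOrdered hlt
  have : Nonempty Ω := ⟨x⟩
  obtain ⟨S, hS, hSd⟩ := hom.exists_countable_dense hc
  exact nonempty_orderIso_real hS hSd fun L => hom.exists_isLUB hb hS hSd

end LPerm
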